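/- For any bounded measurable function φ on X: E[γ_n^N(1) φ(ζ_n^{K_n¹})] = γ_n(φ), and E[γ_n^N(φ)] = γ_n(φ). -/

import Mathlib

open MeasureTheory ProbabilityTheory Filter
open scoped ENNReal NNReal Classical

noncomputable section

namespace PFVar

variable {X : Type*} [MeasurableSpace X]

/-- The unnormalized Feynman–Kac measures `γ_p`. -/
def gammaFK (M0 : Measure X) (M : ℕ → Kernel X X) (G : ℕ → X → ℝ) : ℕ → Measure X
  | 0 => M0
  | p + 1 =>
      ((gammaFK M0 M G p).withDensity fun x => ENNReal.ofReal (G p x)).bind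
        (fun x => M (p + 1) x)

/-- `γ_n(φ)`. -/
def gInt (M0 : Measure X) (M : ℕ → Kernel X X) (G : ℕ → X → ℝ) (n : ℕ) (φ : X → ℝ) : ℝ :=
  ∫ x, φ x ∂(gammaFK M0 M G n)

/-- `η_n(φ) = γ_n(φ)/γ_n(1)`. -/
def eInt (M0 : Measure X) (M : ℕ → Kernel X X) (G : ℕ → X → ℝ) (n : ℕ) (φ : X → ℝ) : ℝ :=
  gInt M0 M G n φ / gInt M0 M G n 1

/-- Law of the path `(X_0,…,X_k)` of an inhomogeneous Markov chain with initial law `μ0` and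
transitions `κ`, recorded as an element of `ℕ → Y` (coordinates beyond `k` are junk). -/
def markovPath {Y : Type*} [MeasurableSpace Y] (μ0 : Measure Y) (κ : ℕ → Y → Measure Y) :
    ℕ → Measure (ℕ → Y)
  | 0 => μ0.map fun y _ => y
  | k + 1 =>
      (markovPath μ0 κ k).bind fun ω =>
        (κ (k + 1) (ω k)).map fun y => Function.update ω (k + 1) y

/-- Categorical distribution on `{0,…,m−1} ⊆ ℕ` with weights `w`. -/
def cat (m : ℕ) (w : ℕ → ℝ) : Measure ℕ :=
  (∑ j ∈ Finset.range m, ENNReal.ofReal (w j))⁻¹ •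
    ∑ j ∈ Finset.range m, ENNReal.ofReal (w j) • Measure.dirac j

/-- Uniform distribution on `{0,…,m−1}`. -/
def unif (m : ℕ) : Measure ℕ := cat m fun _ => 1

/-- Extend a finite tuple to `ℕ` with junk values. -/
def padF {Y : Type*} [Nonempty Y] {m : ℕ} (f : Fin m → Y) : ℕ → Y := fun i =>
  if h : i < m then f ⟨i, h⟩ else Classical.arbitrary Y

/-- One resampling/mutation step of the particle filter: given the time-`p` configuration `z`,
the joint law of the ancestor indices `A_p` and the time-`p+1` particle configuration;
each of the `Np (p+1)` new particles independently draws an ancestor from the categorical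
distribution with weights `G p (z j)`, `j < Np p`, and then moves according to `M (p+1)`. -/
def pfStep [Nonempty X] (M : ℕ → Kernel X X) (G : ℕ → X → ℝ) (Np : ℕ → ℕ) (p : ℕ)
    (z : ℕ → X) : Measure ((ℕ → ℕ) × (ℕ → X)) :=
  (Measure.pi fun _ : Fin (Np (p + 1)) =>
      (cat (Np p) fun j => G p (z j)).bind fun a =>
        (M (p + 1) (z a)).map fun x => (a, x)).map fun f =>
    (padF fun i => (f i).1, padF fun i => (f i).2)

/-- The law of the particle system `(ζ, A)` run up to time `k`: the first component is
`ζ : time → particle index → X`, the second is `A : time → particle index → ℕ`, where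
`A p i` is the ancestor index of particle `i` of generation `p+1`. -/
def pfLaw [Nonempty X] (M0 : Measure X) (M : ℕ → Kernel X X) (G : ℕ → X → ℝ)
    (Np : ℕ → ℕ) : ℕ → Measure ((ℕ → ℕ → X) × (ℕ → ℕ → ℕ))
  | 0 =>
      (Measure.pi fun _ : Fin (Np 0) => M0).map fun f =>
        (fun p => if p = 0 then padF f else fun _ => Classical.arbitrary X, fun _ _ => 0)
  | k + 1 =>
      (pfLaw M0 M G Np k).bind fun ω =>
        (pfStep M G Np k (ω.1 k)).map fun az =>
          (Function.update ω.1 (k + 1) az.2, Function.update ω.2 k az.1)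

/-- Eve indices: `eve A 0 i = i` and `eve A (p+1) i = eve A p (A p i)`. -/
def eve (A : ℕ → ℕ → ℕ) : ℕ → ℕ → ℕ
  | 0 => fun i => i
  | p + 1 => fun i => eve A p (A p i)

/-- `η_n^N(φ)`. -/
def etaN (Np : ℕ → ℕ) (n : ℕ) (φ : X → ℝ) (ω : (ℕ → ℕ → X) × (ℕ → ℕ → ℕ)) : ℝ :=
  (Np n : ℝ)⁻¹ * ∑ i ∈ Finset.range (Np n), φ (ω.1 n i)

/-- `γ_n^N(φ)`. -/
def gammaN (G : ℕ → X → ℝ) (Np : ℕ → ℕ) (n : ℕ) (φ : X → ℝ)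
    (ω : (ℕ → ℕ → X) × (ℕ → ℕ → ℕ)) : ℝ :=
  (∏ p ∈ Finset.range n, etaN Np p (G p) ω) * etaN Np n φ ω

/-- The variance estimator `V_n^N(φ)`. -/
def Vest (Np : ℕ → ℕ) (n : ℕ) (φ : X → ℝ) (ω : (ℕ → ℕ → X) × (ℕ → ℕ → ℕ)) : ℝ :=
  etaN Np n φ ω ^ 2 -
    (∏ p ∈ Finset.range n, (Np p : ℝ) / ((Np p : ℝ) - 1)) *
      ((Np n : ℝ) * ((Np n : ℝ) - 1))⁻¹ *
      ∑ i ∈ Finset.range (Np n), ∑ j ∈ Finset.range (Np n),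
        if eve ω.2 n i ≠ eve ω.2 n j then φ (ω.1 n i) * φ (ω.1 n j) else 0

/-- Initial law of the doubled chain used to define `μ_b`. -/
def pairInit (M0 : Measure X) (b : ℕ → Bool) : Measure (X × X) :=
  if b 0 then M0.map fun x => (x, x) else M0.prod M0

/-- Transitions of the doubled chain used to define `μ_b`. -/
def pairKer (M : ℕ → Kernel X X) (b : ℕ → Bool) (p : ℕ) (q : X × X) : Measure (X × X) :=
  if b p then (M p q.1).map fun y => (y, y) else (M p q.1).prod (M p q.2)

/-- `μ_b(φ) = E_b[φ(X_n, X_n') ∏_{p<n} G_p(X_p) G_p(X_p')]`. -/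
def muB (M0 : Measure X) (M : ℕ → Kernel X X) (G : ℕ → X → ℝ) (n : ℕ) (b : ℕ → Bool)
    (φ : X × X → ℝ) : ℝ :=
  ∫ ω, φ (ω n) * ∏ p ∈ Finset.range n, G p (ω p).1 * G p (ω p).2
    ∂(markovPath (pairInit M0 b) (pairKer M b) n)

/-- `φ ⊗ φ`. -/
def tens (φ : X → ℝ) : X × X → ℝ := fun q => φ q.1 * φ q.2

/-- The binary string `e_p`. -/
def eVec (p : ℕ) : ℕ → Bool := fun q => q == p

/-- The zero binary string `0_n`. -/
def zeroVec : ℕ → Bool := fun _ => false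

/-- Extension of a finite binary string to `ℕ → Bool`. -/
def extB (n : ℕ) (b : Fin (n + 1) → Bool) : ℕ → Bool := fun p =>
  if h : p < n + 1 then b ⟨p, h⟩ else false

/-- `v_{p,n}(φ) = (μ_{e_p}(φ⊗φ) − μ_{0_n}(φ⊗φ)) / γ_n(1)²`. -/
def vpn (M0 : Measure X) (M : ℕ → Kernel X X) (G : ℕ → X → ℝ) (n p : ℕ) (φ : X → ℝ) : ℝ :=
  (muB M0 M G n (eVec p) (tens φ) - muB M0 M G n zeroVec (tens φ)) / gInt M0 M G n 1 ^ 2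

/-- `σ_n²(φ) = Σ_{p=0}^n c_p⁻¹ v_{p,n}(φ)`. -/
def sigma2 (M0 : Measure X) (M : ℕ → Kernel X X) (G : ℕ → X → ℝ) (c : ℕ → ℝ) (n : ℕ)
    (φ : X → ℝ) : ℝ :=
  ∑ p ∈ Finset.range (n + 1), (c p)⁻¹ * vpn M0 M G n p φ

/-- Particle numbers `N_p = ⌈c_p N⌉`. -/
def npart (c : ℕ → ℝ) (N : ℕ) (p : ℕ) : ℕ := ⌈c p * (N : ℝ)⌉₊

/-- Backward tracing: `traceAux A n kn j = K_{n-j}` where `K_n = kn`, `K_p = A p (K_{p+1})`. -/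
def traceAux (A : ℕ → ℕ → ℕ) (n kn : ℕ) : ℕ → ℕ
  | 0 => kn
  | j + 1 => A (n - (j + 1)) (traceAux A n kn j)

/-- The deterministic ancestral trace `K¹`: `trace A n kn p = K_p¹` given `K_n¹ = kn`. -/
def trace (A : ℕ → ℕ → ℕ) (n kn : ℕ) : ℕ → ℕ := fun p => traceAux A n kn (n - p)

/-- Conditional law of the broken-lineage trace `(K_0²,…,K_p²)` given `K_p² = v`
(entries above `p` are junk, to be overwritten). -/
def k2Law (G : ℕ → X → ℝ) (Np : ℕ → ℕ) (ω : (ℕ → ℕ → X) × (ℕ → ℕ → ℕ)) (K1 : ℕ → ℕ) :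
    ℕ → ℕ → Measure (ℕ → ℕ)
  | 0 => fun v => Measure.dirac fun q => if q = 0 then v else 0
  | p + 1 => fun v =>
      ((if v = K1 (p + 1) then cat (Np p) fun j => G p (ω.1 p j)
          else Measure.dirac (ω.2 p v)).bind fun w =>
        (k2Law G Np ω K1 p w).map fun f => Function.update f (p + 1) v)

/-- Conditional law of `(K¹, K²)` given the particle system `ω = (ζ, A)`. -/
def kLaw (G : ℕ → X → ℝ) (Np : ℕ → ℕ) (n : ℕ) (ω : (ℕ → ℕ → X) × (ℕ → ℕ → ℕ)) :
    Measure ((ℕ → ℕ) × (ℕ → ℕ)) :=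
  (unif (Np n)).bind fun k1n =>
    (unif (Np n)).bind fun k2n =>
      (k2Law G Np ω (trace ω.2 n k1n) n k2n).map fun k2 => (trace ω.2 n k1n, k2)

/-- Joint law of the particle system together with the tracing variables `(K¹, K²)`. -/
def pfkLaw [Nonempty X] (M0 : Measure X) (M : ℕ → Kernel X X) (G : ℕ → X → ℝ)
    (Np : ℕ → ℕ) (n : ℕ) :
    Measure (((ℕ → ℕ → X) × (ℕ → ℕ → ℕ)) × ((ℕ → ℕ) × (ℕ → ℕ))) :=
  (pfLaw M0 M G Np n).bind fun ω => (kLaw G Np n ω).map fun k => (ω, k)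

/-- `(k¹, k²) ∈ I(b)`. -/
def inI (Np : ℕ → ℕ) (n : ℕ) (b : ℕ → Bool) (k : (ℕ → ℕ) × (ℕ → ℕ)) : Prop :=
  ∀ p ≤ n, k.1 p < Np p ∧ k.2 p < Np p ∧ (k.1 p = k.2 p ↔ b p = true)

/-- The particle approximation `μ_b^N(φ)` (a function of the realization `ω = (ζ, A)`);
the conditional expectation given `(A, ζ)` is the integral with respect to `kLaw`. -/
def muBN (G : ℕ → X → ℝ) (Np : ℕ → ℕ) (n : ℕ) (b : ℕ → Bool) (φ : X × X → ℝ)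
    (ω : (ℕ → ℕ → X) × (ℕ → ℕ → ℕ)) : ℝ :=
  (∏ p ∈ Finset.range (n + 1),
      if b p then (Np p : ℝ) else (Np p : ℝ) / ((Np p : ℝ) - 1)) *
    gammaN G Np n 1 ω ^ 2 *
    ∫ k, (if inI Np n b k then (1 : ℝ) else 0) * φ (ω.1 n (k.1 n), ω.1 n (k.2 n))
      ∂(kLaw G Np n ω)

/-- `v_{p,n}^N(φ)`. -/
def vpnN (G : ℕ → X → ℝ) (Np : ℕ → ℕ) (n p : ℕ) (φ : X → ℝ)
    (ω : (ℕ → ℕ → X) × (ℕ → ℕ → ℕ)) : ℝ :=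
  (muBN G Np n (eVec p) (tens φ) ω - muBN G Np n zeroVec (tens φ) ω) / gammaN G Np n 1 ω ^ 2

/-- `v_n^N(φ) = Σ_{p=0}^n c_p⁻¹ v_{p,n}^N(φ)`. -/
def vnN (G : ℕ → X → ℝ) (Np : ℕ → ℕ) (c : ℕ → ℝ) (n : ℕ) (φ : X → ℝ)
    (ω : (ℕ → ℕ → X) × (ℕ → ℕ → ℕ)) : ℝ :=
  ∑ p ∈ Finset.range (n + 1), (c p)⁻¹ * vpnN G Np n p φ ω

/-- `QAux M G n φ j = Q_{n-j,n}(φ)`. -/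
def QAux (M : ℕ → Kernel X X) (G : ℕ → X → ℝ) (n : ℕ) (φ : X → ℝ) : ℕ → X → ℝ
  | 0 => φ
  | j + 1 => fun x => G (n - (j + 1)) x * ∫ y, QAux M G n φ j y ∂(M (n - j) x)

/-- `Q_{p,n}(φ)` where `Q_p(x, dx') = G_{p-1}(x) M_p(x, dx')`, `Q_{n,n} = Id`,
`Q_{p,n} = Q_{p+1} ⋯ Q_n`. -/
def Qpn (M : ℕ → Kernel X X) (G : ℕ → X → ℝ) (n p : ℕ) (φ : X → ℝ) : X → ℝ :=
  QAux M G n φ (n - p)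

/-- `φ̂ = G_n · φ`. -/
def hatf (G : ℕ → X → ℝ) (n : ℕ) (φ : X → ℝ) : X → ℝ := fun x => G n x * φ x

/-- `γ̂_n(φ) = γ_n(G_n φ)`. -/
def gHatInt (M0 : Measure X) (M : ℕ → Kernel X X) (G : ℕ → X → ℝ) (n : ℕ) (φ : X → ℝ) : ℝ :=
  gInt M0 M G n (hatf G n φ)

/-- `η̂_n(φ) = γ̂_n(φ)/γ̂_n(1)`. -/
def eHatInt (M0 : Measure X) (M : ℕ → Kernel X X) (G : ℕ → X → ℝ) (n : ℕ) (φ : X → ℝ) : ℝ :=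
  gHatInt M0 M G n φ / gHatInt M0 M G n 1

/-- `γ̂_n^N(φ) = γ_n^N(G_n φ)`. -/
def gammaHatN (G : ℕ → X → ℝ) (Np : ℕ → ℕ) (n : ℕ) (φ : X → ℝ)
    (ω : (ℕ → ℕ → X) × (ℕ → ℕ → ℕ)) : ℝ :=
  gammaN G Np n (hatf G n φ) ω

/-- `η̂_n^N(φ) = γ̂_n^N(φ)/γ̂_n^N(1)`. -/
def etaHatN (G : ℕ → X → ℝ) (Np : ℕ → ℕ) (n : ℕ) (φ : X → ℝ)
    (ω : (ℕ → ℕ → X) × (ℕ → ℕ → ℕ)) : ℝ :=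
  gammaHatN G Np n φ ω / gammaHatN G Np n 1 ω

/-- `v̂_{p,n}(φ) = v_{p,n}(φ̂)/η_n(G_n)²`. -/
def vpnHat (M0 : Measure X) (M : ℕ → Kernel X X) (G : ℕ → X → ℝ) (n p : ℕ) (φ : X → ℝ) : ℝ :=
  vpn M0 M G n p (hatf G n φ) / eInt M0 M G n (G n) ^ 2

/-- `σ̂_n²(φ) = Σ_{p=0}^n c_p⁻¹ v̂_{p,n}(φ)`. -/
def sigma2Hat (M0 : Measure X) (M : ℕ → Kernel X X) (G : ℕ → X → ℝ) (c : ℕ → ℝ) (n : ℕ)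
    (φ : X → ℝ) : ℝ :=
  ∑ p ∈ Finset.range (n + 1), (c p)⁻¹ * vpnHat M0 M G n p φ

/-- `V̂_n^N(φ) = V_n^N(φ̂)/η_n^N(G_n)²`. -/
def VestHat (G : ℕ → X → ℝ) (Np : ℕ → ℕ) (n : ℕ) (φ : X → ℝ)
    (ω : (ℕ → ℕ → X) × (ℕ → ℕ → ℕ)) : ℝ :=
  Vest Np n (hatf G n φ) ω / etaN Np n (G n) ω ^ 2

/-- `v̂_{p,n}^N(φ) = v_{p,n}^N(φ̂)/η_n^N(G_n)²`. -/
def vpnHatN (G : ℕ → X → ℝ) (Np : ℕ → ℕ) (n p : ℕ) (φ : X → ℝ)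
    (ω : (ℕ → ℕ → X) × (ℕ → ℕ → ℕ)) : ℝ :=
  vpnN G Np n p (hatf G n φ) ω / etaN Np n (G n) ω ^ 2

/-- `v̂_n^N(φ) = Σ_{p=0}^n c_p⁻¹ v̂_{p,n}^N(φ)`. -/
def vnHatN (G : ℕ → X → ℝ) (Np : ℕ → ℕ) (c : ℕ → ℝ) (n : ℕ) (φ : X → ℝ)
    (ω : (ℕ → ℕ → X) × (ℕ → ℕ → ℕ)) : ℝ :=
  ∑ p ∈ Finset.range (n + 1), (c p)⁻¹ * vpnHatN G Np n p φ ω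


open PFVar MeasureTheory ProbabilityTheory Filter

section Measurability

variable {α β γ : Type*} [MeasurableSpace α] [MeasurableSpace β] [MeasurableSpace γ]

lemma measurable_map_param {f : α → Measure β} (hf : Measurable f)
    (hp : ∀ a, IsProbabilityMeasure (f a)) {g : α → β → γ}
    (hg : Measurable (Function.uncurry g)) : Measurable fun a => (f a).map (g a) := by
  refine Measure.measurable_of_measurable_coe _ fun s hs => ?_
  let κ : Kernel α β := ⟨f, hf⟩
  have : IsMarkovKernel κ := ⟨hp⟩
  have h := Kernel.measurable_kernel_prodMk_left (κ := κ) (hg hs)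
  simp_rw [fun a => Measure.map_apply (μ := f a) (f := g a) (hg.comp measurable_prodMk_left) hs]
  exact h

lemma measurable_bind_nat {f : α → Measure ℕ} (hf : Measurable f) {g : α → ℕ → Measure γ}
    (hg : ∀ k, Measurable fun a => g a k) : Measurable fun a => (f a).bind (g a) := by
  refine Measure.measurable_of_measurable_coe _ fun s hs => ?_
  have h : ∀ a, (f a).bind (g a) s = ∑' k, g a k s * f a {k} := fun a => by
    rw [Measure.bind_apply hs measurable_from_top.aemeasurable, lintegral_countable']
  simp_rw [h]
  refine Measurable.tsum fun k => ?_
  exact ((Measure.measurable_coe hs).comp (hg k)).mul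
    ((Measure.measurable_coe (measurableSet_singleton k)).comp hf)

lemma measurable_pi_const {ι : Type*} [Fintype ι] {f : α → Measure β} (hf : Measurable f)
    (hp : ∀ a, IsProbabilityMeasure (f a)) :
    Measurable fun a => Measure.pi fun _ : ι => f a := by
  refine Measurable.measure_of_isPiSystem_of_isProbabilityMeasure generateFrom_pi.symm
    isPiSystem_pi ?_
  rintro _ ⟨s, hs, rfl⟩
  simp_rw [Measure.pi_pi]
  exact Finset.measurable_prod _ fun i _ =>
    (Measure.measurable_coe (hs i (Set.mem_univ i))).comp hf

lemma isProbabilityMeasure_bind' {m : Measure α} [IsProbabilityMeasure m] {f : α → Measure β}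
    (hf : Measurable f) (hp : ∀ a, IsProbabilityMeasure (f a)) :
    IsProbabilityMeasure (m.bind f) :=
  ⟨by simp [Measure.bind_apply MeasurableSet.univ hf.aemeasurable]⟩

lemma lintegral_bind_map {δ : Type*} [MeasurableSpace δ] {m : Measure α} {f : α → Measure β}
    (hf : Measurable f) (hp : ∀ a, IsProbabilityMeasure (f a)) {g : α → β → δ}
    (hg : Measurable (Function.uncurry g)) {F : δ → ℝ≥0∞} (hF : Measurable F) :
    ∫⁻ x, F x ∂(m.bind fun a => (f a).map (g a)) = ∫⁻ a, ∫⁻ b, F (g a b) ∂f a ∂m := by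
  rw [Measure.lintegral_bind (measurable_map_param hf hp hg).aemeasurable hF.aemeasurable]
  refine lintegral_congr fun a => ?_
  exact lintegral_map hF (hg.comp measurable_prodMk_left)

lemma measurable_padF [Nonempty β] {m : ℕ} {g : α → Fin m → β} (hg : Measurable g) :
    Measurable fun a => padF (g a) := by
  refine measurable_pi_iff.2 fun i => ?_
  unfold padF
  split_ifs with h
  · exact (measurable_pi_apply _).comp hg
  · exact measurable_const

lemma measurable_cat {m : ℕ} {w : α → ℕ → ℝ} (hw : ∀ j, Measurable fun a => w a j) :
    Measurable fun a => cat m (w a) := by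
  refine Measure.measurable_of_measurable_coe _ fun s hs => ?_
  simp only [cat, Measure.smul_apply, Measure.finsetSum_apply, smul_eq_mul]
  have := fun j => (hw j).ennreal_ofReal
  fun_prop

end Measurability

lemma isProbabilityMeasure_cat {m : ℕ} (hm : 0 < m) {w : ℕ → ℝ} (hw : ∀ j, 0 < w j) :
    IsProbabilityMeasure (cat m w) := by
  constructor
  simp only [cat, Measure.smul_apply, Measure.finsetSum_apply, smul_eq_mul, measure_univ, mul_one]
  refine ENNReal.inv_mul_cancel ?_ (by simp)
  have : (0 : ℕ) ∈ Finset.range m := by simpa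
  simp only [ne_eq, Finset.sum_eq_zero_iff, not_forall]
  exact ⟨0, this, by simpa using hw 0⟩

lemma lintegral_cat (m : ℕ) (w : ℕ → ℝ) (f : ℕ → ℝ≥0∞) :
    ∫⁻ j, f j ∂(cat m w) = (∑ j ∈ Finset.range m, ENNReal.ofReal (w j))⁻¹ *
      ∑ j ∈ Finset.range m, ENNReal.ofReal (w j) * f j := by
  simp [cat, lintegral_smul_measure]

lemma isProbabilityMeasure_unif {m : ℕ} (hm : 0 < m) : IsProbabilityMeasure (unif m) :=
  isProbabilityMeasure_cat hm fun _ => one_pos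

lemma lintegral_unif (m : ℕ) (f : ℕ → ℝ≥0∞) :
    ∫⁻ j, f j ∂(unif m) = (m : ℝ≥0∞)⁻¹ * ∑ j ∈ Finset.range m, f j := by
  simp [unif, lintegral_cat]

/-- The `ℝ≥0∞`-valued counterpart of `etaN`. -/
def elN {X : Type*} (Np : ℕ → ℕ) (n : ℕ) (f : X → ℝ≥0∞)
    (ω : (ℕ → ℕ → X) × (ℕ → ℕ → ℕ)) : ℝ≥0∞ :=
  (Np n : ℝ≥0∞)⁻¹ * ∑ i ∈ Finset.range (Np n), f (ω.1 n i)

/-- The `ℝ≥0∞`-valued counterpart of the product of the `etaN Np p (G p)`. -/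
def plN {X : Type*} (G : ℕ → X → ℝ) (Np : ℕ → ℕ) (n : ℕ)
    (ω : (ℕ → ℕ → X) × (ℕ → ℕ → ℕ)) : ℝ≥0∞ :=
  ∏ p ∈ Finset.range n, elN Np p (fun x => ENNReal.ofReal (G p x)) ω

section Real

variable {X : Type*}

lemma etaN_nonneg {Np : ℕ → ℕ} {n : ℕ} {φ : X → ℝ} (hφ : ∀ x, 0 ≤ φ x)
    (ω : (ℕ → ℕ → X) × (ℕ → ℕ → ℕ)) : 0 ≤ etaN Np n φ ω :=
  mul_nonneg (by positivity) (Finset.sum_nonneg fun _ _ => hφ _)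

lemma ofReal_etaN {Np : ℕ → ℕ} {n : ℕ} (hN : 0 < Np n) {φ : X → ℝ} (hφ : ∀ x, 0 ≤ φ x)
    (ω : (ℕ → ℕ → X) × (ℕ → ℕ → ℕ)) :
    ENNReal.ofReal (etaN Np n φ ω) = elN Np n (fun x => ENNReal.ofReal (φ x)) ω := by
  rw [etaN, elN, ENNReal.ofReal_mul (by positivity), ENNReal.ofReal_sum_of_nonneg fun _ _ => hφ _,
    ENNReal.ofReal_inv_of_pos (by positivity), ENNReal.ofReal_natCast]

lemma etaN_one {Np : ℕ → ℕ} {n : ℕ} (hN : 0 < Np n)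
    (ω : (ℕ → ℕ → X) × (ℕ → ℕ → ℕ)) : etaN Np n (1 : X → ℝ) ω = 1 := by
  have : (Np n : ℝ) ≠ 0 := by positivity
  simp [etaN, this]

variable {G : ℕ → X → ℝ} {Np : ℕ → ℕ} {n : ℕ}

lemma prod_etaN_nonneg (hG : ∀ p < n, ∀ x, 0 < G p x) (ω : (ℕ → ℕ → X) × (ℕ → ℕ → ℕ)) :
    0 ≤ ∏ p ∈ Finset.range n, etaN Np p (G p) ω :=
  Finset.prod_nonneg fun p hp => etaN_nonneg (fun x => (hG p (Finset.mem_range.1 hp) x).le) ω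

lemma gammaN_one (hN : 0 < Np n) (ω : (ℕ → ℕ → X) × (ℕ → ℕ → ℕ)) :
    gammaN G Np n (1 : X → ℝ) ω = ∏ p ∈ Finset.range n, etaN Np p (G p) ω := by
  rw [gammaN, etaN_one hN, mul_one]

lemma gammaN_nonneg (hG : ∀ p < n, ∀ x, 0 < G p x) {φ : X → ℝ} (hφ : ∀ x, 0 ≤ φ x)
    (ω : (ℕ → ℕ → X) × (ℕ → ℕ → ℕ)) : 0 ≤ gammaN G Np n φ ω :=
  mul_nonneg (prod_etaN_nonneg hG ω) (etaN_nonneg hφ ω)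

lemma ofReal_prod_etaN (hN : ∀ p < n, 0 < Np p) (hG : ∀ p < n, ∀ x, 0 < G p x)
    (ω : (ℕ → ℕ → X) × (ℕ → ℕ → ℕ)) :
    ENNReal.ofReal (∏ p ∈ Finset.range n, etaN Np p (G p) ω) = plN G Np n ω := by
  rw [plN, ENNReal.ofReal_prod_of_nonneg
    fun p hp => etaN_nonneg (fun x => (hG p (Finset.mem_range.1 hp) x).le) ω]
  exact Finset.prod_congr rfl fun p hp => ofReal_etaN (hN p (Finset.mem_range.1 hp))
    (fun x => (hG p (Finset.mem_range.1 hp) x).le) ω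

lemma etaN_sub (φ ψ : X → ℝ) (ω : (ℕ → ℕ → X) × (ℕ → ℕ → ℕ)) :
    etaN Np n (φ - ψ) ω = etaN Np n φ ω - etaN Np n ψ ω := by
  simp [etaN, mul_sub]

lemma plN_update (k : ℕ) (ω : (ℕ → ℕ → X) × (ℕ → ℕ → ℕ)) (z : ℕ → X)
    (A : ℕ → ℕ → ℕ) : plN G Np (k + 1) (Function.update ω.1 (k + 1) z, A) =
      plN G Np (k + 1) ω := by
  refine Finset.prod_congr rfl fun p hp => ?_
  simp only [elN, Function.update_of_ne (Finset.mem_range.1 hp).ne]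

end Real

section ParticleSystem

variable {X : Type*} [MeasurableSpace X]

lemma measurable_particle (p i : ℕ) :
    Measurable fun ω : (ℕ → ℕ → X) × (ℕ → ℕ → ℕ) => ω.1 p i := by fun_prop

lemma measurable_etaN {Np : ℕ → ℕ} {n : ℕ} {φ : X → ℝ} (hφ : Measurable φ) :
    Measurable (etaN Np n φ) :=
  (Finset.measurable_fun_sum _ fun i _ => hφ.comp (measurable_particle n i)).const_mul _

lemma measurable_elN {Np : ℕ → ℕ} {n : ℕ} {f : X → ℝ≥0∞} (hf : Measurable f) :
    Measurable (elN Np n f) :=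
  (Finset.measurable_fun_sum _ fun i _ => hf.comp (measurable_particle n i)).const_mul _

lemma measurable_plN {G : ℕ → X → ℝ} {Np : ℕ → ℕ} {n : ℕ} (hG : ∀ p < n, Measurable (G p)) :
    Measurable (plN G Np n) :=
  Finset.measurable_fun_prod _ fun p hp =>
    measurable_elN (hG p (Finset.mem_range.1 hp)).ennreal_ofReal

lemma measurable_gammaN {G : ℕ → X → ℝ} {Np : ℕ → ℕ} {n : ℕ} (hG : ∀ p < n, Measurable (G p))
    {φ : X → ℝ} (hφ : Measurable φ) : Measurable (gammaN G Np n φ) :=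
  (Finset.measurable_fun_prod _ fun p hp => measurable_etaN (hG p (Finset.mem_range.1 hp))).mul
    (measurable_etaN hφ)

/-- Joint law of the ancestor index and the position of a single new particle. -/
def moveLaw (M : ℕ → Kernel X X) (G : ℕ → X → ℝ) (Np : ℕ → ℕ) (p : ℕ) (z : ℕ → X) :
    Measure (ℕ × X) :=
  (cat (Np p) fun j => G p (z j)).bind fun a => (M (p + 1) (z a)).map fun x => (a, x)

variable {M : ℕ → Kernel X X} {G : ℕ → X → ℝ} {Np : ℕ → ℕ} {p : ℕ}

lemma isProbabilityMeasure_moveLaw [∀ p, IsMarkovKernel (M p)] (hN : 0 < Np p) (hG : ∀ x, 0 < G p x) (z : ℕ → X) :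
    IsProbabilityMeasure (moveLaw M G Np p z) := by
  have := isProbabilityMeasure_cat hN fun j => hG (z j)
  exact isProbabilityMeasure_bind' measurable_from_top fun a =>
    Measure.isProbabilityMeasure_map measurable_prodMk_left.aemeasurable

lemma measurable_moveLaw (hGm : Measurable (G p)) : Measurable (moveLaw M G Np p) := by
  refine measurable_bind_nat (measurable_cat fun j => hGm.comp (measurable_pi_apply j)) fun k => ?_
  exact (Measure.measurable_map _ measurable_prodMk_left).comp
    ((M (p + 1)).measurable.comp (measurable_pi_apply k))

lemma lintegral_moveLaw {f : X → ℝ≥0∞} (hf : Measurable f) (z : ℕ → X) :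
    ∫⁻ q, f q.2 ∂(moveLaw M G Np p z) =
      (∑ j ∈ Finset.range (Np p), ENNReal.ofReal (G p (z j)))⁻¹ *
        ∑ j ∈ Finset.range (Np p), ENNReal.ofReal (G p (z j)) * ∫⁻ y, f y ∂(M (p + 1) (z j)) := by
  rw [moveLaw, Measure.lintegral_bind measurable_from_top.aemeasurable (by fun_prop), lintegral_cat]
  congr! 4 with j
  rw [lintegral_map (by fun_prop) measurable_prodMk_left]

lemma isProbabilityMeasure_pfStep [Nonempty X] [∀ p, IsMarkovKernel (M p)]
    (hN : 0 < Np p) (hG : ∀ x, 0 < G p x) (z : ℕ → X) :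
    IsProbabilityMeasure (pfStep M G Np p z) := by
  have := isProbabilityMeasure_moveLaw (M := M) hN hG z
  refine Measure.isProbabilityMeasure_map (Measurable.aemeasurable ?_)
    (μ := Measure.pi fun _ : Fin (Np (p + 1)) => moveLaw M G Np p z)
  exact (measurable_padF (by fun_prop)).prodMk (measurable_padF (by fun_prop))

lemma measurable_pfStep [Nonempty X] [∀ p, IsMarkovKernel (M p)]
    (hN : 0 < Np p) (hG : ∀ x, 0 < G p x) (hGm : Measurable (G p)) :
    Measurable (pfStep M G Np p) := by
  refine (Measure.measurable_map _ ?_).comp (measurable_pi_const (measurable_moveLaw hGm)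
    fun z => isProbabilityMeasure_moveLaw hN hG z)
  exact (measurable_padF (by fun_prop)).prodMk (measurable_padF (by fun_prop))

lemma lintegral_pfStep [Nonempty X] [∀ p, IsMarkovKernel (M p)]
    (hN : 0 < Np p) (hG : ∀ x, 0 < G p x) {f : X → ℝ≥0∞} (hf : Measurable f)
    {i : ℕ} (hi : i < Np (p + 1)) (z : ℕ → X) :
    ∫⁻ az, f (az.2 i) ∂(pfStep M G Np p z) = ∫⁻ q, f q.2 ∂(moveLaw M G Np p z) := by
  have := isProbabilityMeasure_moveLaw (M := M) hN hG z
  have hm : Measurable fun g : Fin (Np (p + 1)) → ℕ × X =>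
      (padF fun i => (g i).1, padF fun i => (g i).2) :=
    (measurable_padF (by fun_prop)).prodMk (measurable_padF (by fun_prop))
  have h := lintegral_map (μ := Measure.pi fun _ : Fin (Np (p + 1)) => moveLaw M G Np p z)
    (f := fun az : (ℕ → ℕ) × (ℕ → X) => f (az.2 i)) (by fun_prop) hm
  refine h.trans ?_
  simp only [padF, hi, dif_pos]
  exact (measurePreserving_eval (fun _ : Fin (Np (p + 1)) => moveLaw M G Np p z)
    ⟨i, hi⟩).lintegral_comp (f := fun q => f q.2) (by fun_prop)

lemma measurable_extend (k : ℕ) : Measurable (Function.uncurry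
    fun (ω : (ℕ → ℕ → X) × (ℕ → ℕ → ℕ)) (az : (ℕ → ℕ) × (ℕ → X)) =>
      (Function.update ω.1 (k + 1) az.2, Function.update ω.2 k az.1)) := by
  refine Measurable.prodMk ?_ ?_
  · refine measurable_pi_iff.2 fun q => ?_
    by_cases h : q = k + 1
    · subst h; simp only [Function.update_self]; fun_prop
    · simp only [Function.update_of_ne h]; fun_prop
  · refine measurable_pi_iff.2 fun q => ?_
    by_cases h : q = k
    · subst h; simp only [Function.update_self]; fun_prop
    · simp only [Function.update_of_ne h]; fun_prop

lemma mul_sum_move (hN : 0 < Np p) (hG : ∀ x, 0 < G p x) {f : X → ℝ≥0∞} (hf : Measurable f)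
    (ω : (ℕ → ℕ → X) × (ℕ → ℕ → ℕ)) :
    elN Np p (fun x => ENNReal.ofReal (G p x)) ω * ∫⁻ q, f q.2 ∂(moveLaw M G Np p (ω.1 p)) =
      elN Np p (fun x => ENNReal.ofReal (G p x) * ∫⁻ y, f y ∂(M (p + 1) x)) ω := by
  have h0 : ∑ j ∈ Finset.range (Np p), ENNReal.ofReal (G p (ω.1 p j)) ≠ 0 := by
    have : (0 : ℕ) ∈ Finset.range (Np p) := by simpa
    simp only [ne_eq, Finset.sum_eq_zero_iff, not_forall]
    exact ⟨0, this, by simpa using hG (ω.1 p 0)⟩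
  rw [lintegral_moveLaw hf, elN, elN, mul_assoc, ← mul_assoc (∑ j ∈ _, _),
    ENNReal.mul_inv_cancel h0 (by simp), one_mul]

/-- Unbiasedness of the particle approximation, for nonnegative test functions. -/
lemma lintegral_pfLaw [Nonempty X] [∀ p, IsMarkovKernel (M p)] (M0 : Measure X) [IsProbabilityMeasure M0] (n : ℕ)
    (hN : ∀ p ≤ n, 0 < Np p) (hG : ∀ p < n, ∀ x, 0 < G p x) (hGm : ∀ p < n, Measurable (G p))
    {f : X → ℝ≥0∞} (hf : Measurable f) :
    ∫⁻ ω, plN G Np n ω * elN Np n f ω ∂(pfLaw M0 M G Np n) = ∫⁻ x, f x ∂(gammaFK M0 M G n) := by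
  induction n generalizing f with
  | zero =>
    have hm : Measurable fun g : Fin (Np 0) → X =>
        ((fun p => if p = 0 then padF g else fun _ => Classical.arbitrary X, fun _ _ => 0) :
          (ℕ → ℕ → X) × (ℕ → ℕ → ℕ)) := by
      refine Measurable.prodMk (measurable_pi_iff.2 fun q => ?_) measurable_const
      split_ifs
      · exact measurable_padF measurable_id
      · exact measurable_const
    simp only [plN, Finset.range_zero, Finset.prod_empty, one_mul, pfLaw, gammaFK]
    rw [lintegral_map (measurable_elN hf) hm]
    simp only [elN, if_true]
    have hfi : ∀ i, Measurable fun g : Fin (Np 0) → X => f (padF g i) := fun i =>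
      hf.comp ((measurable_pi_apply i).comp (measurable_padF measurable_id))
    rw [lintegral_const_mul _ (Finset.measurable_fun_sum _ fun i _ => hfi i),
      lintegral_finsetSum _ fun i _ => hfi i]
    have h : ∀ i ∈ Finset.range (Np 0), ∫⁻ g : Fin (Np 0) → X, f (padF g i)
        ∂(Measure.pi fun _ => M0) = ∫⁻ x, f x ∂M0 := fun i hi => by
      simp only [padF, Finset.mem_range.1 hi, dif_pos]
      exact (measurePreserving_eval (fun _ : Fin (Np 0) => M0) ⟨i, _⟩).lintegral_comp hf
    have hN0 : (Np 0 : ℝ≥0∞) ≠ 0 := by simpa using (hN 0 le_rfl).ne'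
    rw [Finset.sum_congr rfl h, Finset.sum_const, Finset.card_range, nsmul_eq_mul, ← mul_assoc,
      ENNReal.inv_mul_cancel hN0 (by simp), one_mul]
  | succ k ih =>
    have hNk := hN k (Nat.le_succ k)
    have hGk := hG k (Nat.lt_succ_self k)
    have hGmk := hGm k (Nat.lt_succ_self k)
    have hpl := measurable_plN (Np := Np) hGm
    have hMf : Measurable fun x => ∫⁻ y, f y ∂(M (k + 1) x) := hf.lintegral_kernel
    have hN1 : (Np (k + 1) : ℝ≥0∞) ≠ 0 := by simpa using (hN (k + 1) le_rfl).ne'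
    have hinner : ∀ ω : (ℕ → ℕ → X) × (ℕ → ℕ → ℕ),
        ∫⁻ az, plN G Np (k + 1) (Function.update ω.1 (k + 1) az.2, Function.update ω.2 k az.1) *
          elN Np (k + 1) f (Function.update ω.1 (k + 1) az.2, Function.update ω.2 k az.1)
            ∂(pfStep M G Np k (ω.1 k)) =
        plN G Np k ω *
          elN Np k (fun x => ENNReal.ofReal (G k x) * ∫⁻ y, f y ∂(M (k + 1) x)) ω := fun ω => by
      simp only [plN_update, elN, Function.update_self]
      rw [lintegral_const_mul _ (by fun_prop), lintegral_const_mul _ (by fun_prop),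
        lintegral_finsetSum _ (by fun_prop), Finset.sum_congr rfl fun i hi =>
          lintegral_pfStep hNk hGk hf (Finset.mem_range.1 hi) (ω.1 k), Finset.sum_const,
        Finset.card_range, nsmul_eq_mul, ← mul_assoc (_⁻¹), ENNReal.inv_mul_cancel hN1 (by simp),
        one_mul, plN, Finset.prod_range_succ, mul_assoc, mul_sum_move hNk hGk hf]
      rfl
    have hstep : Measurable fun ω : (ℕ → ℕ → X) × (ℕ → ℕ → ℕ) => pfStep M G Np k (ω.1 k) :=
      (measurable_pfStep hNk hGk hGmk).comp (by fun_prop)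
    have hF : Measurable fun ω => plN G Np (k + 1) ω * elN Np (k + 1) f ω :=
      hpl.mul (measurable_elN hf)
    have ih' := ih (fun p hp => hN p (by omega)) (fun p hp => hG p (by omega))
      (fun p hp => hGm p (by omega)) (f := fun x => ENNReal.ofReal (G k x) *
        ∫⁻ y, f y ∂(M (k + 1) x)) (hGmk.ennreal_ofReal.mul hMf)
    rw [pfLaw, lintegral_bind_map hstep (fun ω => isProbabilityMeasure_pfStep hNk hGk _)
      (measurable_extend k) hF, lintegral_congr hinner, ih', gammaFK,
      Measure.lintegral_bind (M (k + 1)).measurable.aemeasurable hf.aemeasurable,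
      lintegral_withDensity_eq_lintegral_mul _ hGmk.ennreal_ofReal hMf]
    rfl

end ParticleSystem

section Tracing

variable {X : Type*} {G : ℕ → X → ℝ} {Np : ℕ → ℕ} {n : ℕ}

lemma isProbabilityMeasure_k2Law (hN : ∀ p < n, 0 < Np p) (hG : ∀ p < n, ∀ x, 0 < G p x)
    (ω : (ℕ → ℕ → X) × (ℕ → ℕ → ℕ)) (K : ℕ → ℕ) (v : ℕ) :
    IsProbabilityMeasure (k2Law G Np ω K n v) := by
  induction n generalizing v with
  | zero => rw [k2Law]; infer_instance
  | succ k ih =>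
    have ih' := ih (fun p hp => hN p (by omega)) (fun p hp => hG p (by omega))
    have := isProbabilityMeasure_cat (hN k (by omega)) fun j => hG k (by omega) (ω.1 k j)
    rw [k2Law]
    have : IsProbabilityMeasure (if v = K (k + 1) then cat (Np k) fun j => G k (ω.1 k j)
          else Measure.dirac (ω.2 k v)) := by
      split_ifs <;> infer_instance
    refine isProbabilityMeasure_bind' measurable_from_top fun a => ?_
    exact Measure.isProbabilityMeasure_map (by fun_prop)

lemma isProbabilityMeasure_kLaw (hN : ∀ p ≤ n, 0 < Np p) (hG : ∀ p < n, ∀ x, 0 < G p x)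
    (ω : (ℕ → ℕ → X) × (ℕ → ℕ → ℕ)) : IsProbabilityMeasure (kLaw G Np n ω) := by
  have := isProbabilityMeasure_unif (hN n le_rfl)
  have := isProbabilityMeasure_k2Law (fun p hp => hN p hp.le) hG ω
  refine isProbabilityMeasure_bind' measurable_from_top fun a =>
    isProbabilityMeasure_bind' measurable_from_top fun b =>
      Measure.isProbabilityMeasure_map (by fun_prop)

lemma lintegral_kLaw (hN : ∀ p ≤ n, 0 < Np p) (hG : ∀ p < n, ∀ x, 0 < G p x)
    (f : X → ℝ≥0∞) (ω : (ℕ → ℕ → X) × (ℕ → ℕ → ℕ)) :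
    ∫⁻ k, f (ω.1 n (k.1 n)) ∂(kLaw G Np n ω) = elN Np n f ω := by
  have := isProbabilityMeasure_unif (hN n le_rfl)
  have := isProbabilityMeasure_k2Law (fun p hp => hN p hp.le) hG ω
  have hF : Measurable fun k : (ℕ → ℕ) × (ℕ → ℕ) => f (ω.1 n (k.1 n)) :=
    (measurable_from_top (f := fun i => f (ω.1 n i))).comp (by fun_prop)
  rw [kLaw, Measure.lintegral_bind measurable_from_top.aemeasurable hF.aemeasurable]
  have h : ∀ a, ∫⁻ k, f (ω.1 n (k.1 n)) ∂((unif (Np n)).bind fun k2n =>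
      (k2Law G Np ω (trace ω.2 n a) n k2n).map fun k2 => (trace ω.2 n a, k2)) = f (ω.1 n a) := by
    intro a
    rw [Measure.lintegral_bind measurable_from_top.aemeasurable hF.aemeasurable]
    simp_rw [lintegral_map hF measurable_prodMk_left]
    simp [trace, traceAux]
  rw [lintegral_congr h, lintegral_unif, elN]

variable [MeasurableSpace X]

lemma measurable_k2Law {α : Type*} [MeasurableSpace α] (hGm : ∀ p < n, Measurable (G p))
    {w : α → (ℕ → ℕ → X) × (ℕ → ℕ → ℕ)} (hw : Measurable w)
    {K : α → ℕ → ℕ} (hK : Measurable K) (v : ℕ) :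
    Measurable fun a => k2Law G Np (w a) (K a) n v := by
  induction n generalizing v with
  | zero => exact measurable_const
  | succ k ih =>
    have ih' := ih fun p hp => hGm p (by omega)
    simp only [k2Law]
    refine measurable_bind_nat ?_ fun j => ?_
    · refine Measurable.ite ?_ (measurable_cat fun j =>
        (hGm k (by omega)).comp ((measurable_particle k j).comp hw))
        (Measure.measurable_dirac.comp (by fun_prop))
      have : Measurable fun a => K a (k + 1) := by fun_prop
      exact measurableSet_eq_fun measurable_const this
    · exact (Measure.measurable_map _ (by fun_prop)).comp (ih' j)

lemma measurable_trace (n k : ℕ) :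
    Measurable fun ω : (ℕ → ℕ → X) × (ℕ → ℕ → ℕ) => trace ω.2 n k := by
  have h : ∀ j, Measurable fun ω : (ℕ → ℕ → X) × (ℕ → ℕ → ℕ) => traceAux ω.2 n k j := by
    intro j
    induction j with
    | zero => exact measurable_const
    | succ j ih =>
      have hev : Measurable fun q : (ℕ → ℕ) × ℕ => q.1 q.2 :=
        measurable_from_prod_countable_left fun i => measurable_pi_apply i
      exact hev.comp (Measurable.prodMk (by fun_prop) ih)
  exact measurable_pi_iff.2 fun p => h (n - p)

lemma measurable_kLaw (hN : ∀ p ≤ n, 0 < Np p) (hG : ∀ p < n, ∀ x, 0 < G p x)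
    (hGm : ∀ p < n, Measurable (G p)) :
    Measurable fun ω : (ℕ → ℕ → X) × (ℕ → ℕ → ℕ) => kLaw G Np n ω := by
  refine measurable_bind_nat measurable_const fun k =>
    measurable_bind_nat measurable_const fun l => ?_
  refine measurable_map_param (measurable_k2Law hGm measurable_id (measurable_trace n k) l)
    (fun ω => isProbabilityMeasure_k2Law (fun p hp => hN p hp.le) hG ω _ l) ?_
  exact ((measurable_trace n k).comp measurable_fst).prodMk measurable_snd

lemma measurable_traced : Measurable
    fun q : ((ℕ → ℕ → X) × (ℕ → ℕ → ℕ)) × ((ℕ → ℕ) × (ℕ → ℕ)) => q.1.1 n (q.2.1 n) := by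
  have h : Measurable fun q : (ℕ → X) × ℕ => q.1 q.2 :=
    measurable_from_prod_countable_left fun i => measurable_pi_apply i
  exact h.comp (Measurable.prodMk (by fun_prop) (by fun_prop))

lemma lintegral_pfkLaw [Nonempty X] {M : ℕ → Kernel X X} [∀ p, IsMarkovKernel (M p)]
    (M0 : Measure X) [IsProbabilityMeasure M0]
    (hN : ∀ p ≤ n, 0 < Np p) (hG : ∀ p < n, ∀ x, 0 < G p x) (hGm : ∀ p < n, Measurable (G p))
    {f : X → ℝ≥0∞} (hf : Measurable f) :
    ∫⁻ ωk, plN G Np n ωk.1 * f (ωk.1.1 n (ωk.2.1 n)) ∂(pfkLaw M0 M G Np n) =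
      ∫⁻ x, f x ∂(gammaFK M0 M G n) := by
  have hF : Measurable fun q : ((ℕ → ℕ → X) × (ℕ → ℕ → ℕ)) × ((ℕ → ℕ) × (ℕ → ℕ)) =>
      plN G Np n q.1 * f (q.1.1 n (q.2.1 n)) :=
    ((measurable_plN hGm).comp measurable_fst).mul (hf.comp measurable_traced)
  have hid : Measurable (Function.uncurry
      fun (ω : (ℕ → ℕ → X) × (ℕ → ℕ → ℕ)) (k : (ℕ → ℕ) × (ℕ → ℕ)) => (ω, k)) := measurable_id
  rw [pfkLaw, lintegral_bind_map (measurable_kLaw hN hG hGm)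
    (isProbabilityMeasure_kLaw hN hG) hid hF, ← lintegral_pfLaw M0 n hN hG hGm hf]
  refine lintegral_congr fun ω => ?_
  have hFt : Measurable fun k : (ℕ → ℕ) × (ℕ → ℕ) => f (ω.1 n (k.1 n)) :=
    hf.comp (measurable_traced.comp measurable_prodMk_left)
  rw [← lintegral_kLaw hN hG f ω, ← lintegral_const_mul _ hFt]

end Tracing

lemma isFiniteMeasure_gammaFK {X : Type*} [MeasurableSpace X] (M0 : Measure X)
    [IsProbabilityMeasure M0] (M : ℕ → Kernel X X) [∀ p, IsMarkovKernel (M p)] (G : ℕ → X → ℝ)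
    (n : ℕ) (hGbd : ∀ p < n, ∃ C, ∀ x, G p x ≤ C) :
    IsFiniteMeasure (gammaFK M0 M G n) := by
  induction n with
  | zero => rw [gammaFK]; infer_instance
  | succ k ih =>
    have := ih fun p hp => hGbd p (by omega)
    obtain ⟨C, hC⟩ := hGbd k (by omega)
    refine ⟨?_⟩
    rw [gammaFK, Measure.bind_apply MeasurableSet.univ (M (k + 1)).measurable.aemeasurable]
    simp only [measure_univ, lintegral_const, one_mul, withDensity_apply _ MeasurableSet.univ,
      Measure.restrict_univ]
    calc ∫⁻ x, ENNReal.ofReal (G k x) ∂(gammaFK M0 M G k)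
        ≤ ∫⁻ _, ENNReal.ofReal C ∂(gammaFK M0 M G k) :=
          lintegral_mono fun x => ENNReal.ofReal_le_ofReal (hC x)
      _ < ⊤ := by
          rw [lintegral_const]
          exact ENNReal.mul_lt_top ENNReal.ofReal_lt_top (measure_lt_top _ _)

lemma integral_eq_of_lintegral_eq {Ω X : Type*} [MeasurableSpace Ω] [MeasurableSpace X]
    {μ : Measure Ω} {γ : Measure X} {L : (X → ℝ) → Ω → ℝ}
    (hsub : ∀ φ ψ, L (φ - ψ) = L φ - L ψ) (hmeas : ∀ φ, Measurable φ → Measurable (L φ))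
    (hpos : ∀ φ, (∀ x, 0 ≤ φ x) → ∀ ω, 0 ≤ L φ ω)
    (hL : ∀ φ, Measurable φ → (∀ x, 0 ≤ φ x) →
      ∫⁻ ω, ENNReal.ofReal (L φ ω) ∂μ = ∫⁻ x, ENNReal.ofReal (φ x) ∂γ)
    {φ : X → ℝ} (hφ : Measurable φ) (hint : Integrable φ γ) :
    ∫ ω, L φ ω ∂μ = ∫ x, φ x ∂γ := by
  have key : ∀ ψ, Measurable ψ → (∀ x, 0 ≤ ψ x) → Integrable ψ γ →
      Integrable (L ψ) μ ∧ ∫ ω, L ψ ω ∂μ = ∫ x, ψ x ∂γ := by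
    intro ψ hm h0 hi
    constructor
    · refine ⟨(hmeas ψ hm).aestronglyMeasurable, ?_⟩
      rw [hasFiniteIntegral_iff_ofReal (ae_of_all _ (hpos ψ h0)), hL ψ hm h0]
      exact (hasFiniteIntegral_iff_ofReal (ae_of_all _ h0)).1 hi.2
    · rw [integral_eq_lintegral_of_nonneg_ae (ae_of_all _ (hpos ψ h0))
        (hmeas ψ hm).aestronglyMeasurable, hL ψ hm h0,
        integral_eq_lintegral_of_nonneg_ae (ae_of_all _ h0) hm.aestronglyMeasurable]
  obtain ⟨i1, e1⟩ := key (fun x => max (φ x) 0) (by fun_prop) (fun x => le_max_right _ _)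
    hint.pos_part
  obtain ⟨i2, e2⟩ := key (fun x => max (-φ x) 0) (by fun_prop) (fun x => le_max_right _ _)
    hint.neg_part
  have hdec : φ = (fun x => max (φ x) 0) - fun x => max (-φ x) 0 := by
    ext x
    simp only [Pi.sub_apply]
    rcases le_total 0 (φ x) with h | h <;> simp [h]
  have hLd : L φ = L (fun x => max (φ x) 0) - L (fun x => max (-φ x) 0) := by
    rw [← hsub, ← hdec]
  rw [hLd]
  simp only [Pi.sub_apply]
  rw [integral_sub i1 i2, e1, e2, ← integral_sub hint.pos_part hint.neg_part]
  exact congrArg (fun ψ : X → ℝ => ∫ x, ψ x ∂γ) hdec.symm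

theorem statement5
    {X : Type*} [MeasurableSpace X] [Nonempty X] (hX : ∃ x y : X, x ≠ y) (n : ℕ)
    (M0 : Measure X) [IsProbabilityMeasure M0]
    (M : ℕ → Kernel X X) [∀ p, IsMarkovKernel (M p)]
    (G : ℕ → X → ℝ) (hGm : ∀ p ≤ n, Measurable (G p))
    (hGpos : ∀ p ≤ n, ∀ x, 0 < G p x) (hGbd : ∀ p ≤ n, ∃ C, ∀ x, G p x ≤ C)
    (c : ℕ → ℝ) (hc : ∀ p ≤ n, 0 < c p)
    (φ : X → ℝ) (hφm : Measurable φ) (hφb : ∃ C, ∀ x, |φ x| ≤ C) :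
    ∀ N : ℕ, 1 ≤ N → (∀ p ≤ n, 2 ≤ npart c N p) →
      (∫ ωk, gammaN G (npart c N) n (1 : X → ℝ) ωk.1 * φ (ωk.1.1 n (ωk.2.1 n))
          ∂(pfkLaw M0 M G (npart c N) n) = gInt M0 M G n φ) ∧
      (∫ ω, gammaN G (npart c N) n φ ω ∂(pfLaw M0 M G (npart c N) n)
        = gInt M0 M G n φ) := by
  intro N _ hN2
  have hN : ∀ p ≤ n, 0 < npart c N p := fun p hp => by have := hN2 p hp; omega
  have hG : ∀ p < n, ∀ x, 0 < G p x := fun p hp => hGpos p hp.le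
  have hGm' : ∀ p < n, Measurable (G p) := fun p hp => hGm p hp.le
  have hfin := isFiniteMeasure_gammaFK M0 M G n fun p hp => hGbd p hp.le
  obtain ⟨C, hC⟩ := hφb
  have hint : Integrable φ (gammaFK M0 M G n) :=
    Integrable.of_bound hφm.aestronglyMeasurable C (ae_of_all _ hC)
  have h1 : ∀ ω, 0 ≤ gammaN G (npart c N) n (1 : X → ℝ) ω :=
    gammaN_nonneg hG fun _ => zero_le_one
  have h1m : Measurable (gammaN G (npart c N) n (1 : X → ℝ)) :=
    measurable_gammaN hGm' measurable_one
  constructor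
  · let L : (X → ℝ) → ((ℕ → ℕ → X) × (ℕ → ℕ → ℕ)) × ((ℕ → ℕ) × (ℕ → ℕ)) → ℝ :=
      fun ψ ωk => gammaN G (npart c N) n (1 : X → ℝ) ωk.1 * ψ (ωk.1.1 n (ωk.2.1 n))
    have hsub : ∀ ψ χ, L (ψ - χ) = L ψ - L χ := fun ψ χ => by
      ext ωk
      exact mul_sub _ _ _
    have hmeas : ∀ ψ, Measurable ψ → Measurable (L ψ) := fun ψ hψ =>
      (h1m.comp measurable_fst).mul (hψ.comp measurable_traced)
    have hpos : ∀ ψ, (∀ x, 0 ≤ ψ x) → ∀ ωk, 0 ≤ L ψ ωk := fun ψ hψ ωk =>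
      mul_nonneg (h1 ωk.1) (hψ _)
    refine integral_eq_of_lintegral_eq hsub hmeas hpos (fun ψ hψ h0 => ?_) hφm hint
    rw [← lintegral_pfkLaw M0 hN hG hGm' hψ.ennreal_ofReal]
    refine lintegral_congr fun ωk => ?_
    rw [ENNReal.ofReal_mul (h1 ωk.1), gammaN_one (hN n le_rfl),
      ofReal_prod_etaN (fun p hp => hN p hp.le) hG]
  · refine integral_eq_of_lintegral_eq (L := fun ψ => gammaN G (npart c N) n ψ)
      (fun ψ χ => by ext; simp [gammaN, etaN_sub, mul_sub])
      (fun ψ hψ => measurable_gammaN hGm' hψ)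
      (fun ψ hψ ω => gammaN_nonneg hG hψ ω)
      (fun ψ hψ h0 => ?_) hφm hint
    rw [← lintegral_pfLaw M0 n hN hG hGm' hψ.ennreal_ofReal]
    refine lintegral_congr fun ω => ?_
    rw [gammaN, ENNReal.ofReal_mul (prod_etaN_nonneg hG _),
      ofReal_prod_etaN (fun p hp => hN p hp.le) hG, ofReal_etaN (hN n le_rfl) h0]
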